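/- arXiv:1610.04357 — 3 statements merged into one kernel-verified Lean document; each statement's English description precedes it below -/
import Mathlib

section
/- For every D ∈ ℕ and K ≥ 1 there exists a constant C = C(D,K) > 0 such that for every finite connected simple graph G = (V,E) with |V| ≥ 3 and maximal degree at most D, and every edge weights (c_e)_{e∈E} with K^{−1} ≤ c_e ≤ K for all e ∈ E, one has 1/(C·log|V|) ≤ t_mix(G,(c_e))/t_mix(G) ≤ C·log|V|. -/
open Filter Finset

noncomputable section

variable {V : Type} [Fintype V] [DecidableEq V]

/-- `P` is a row-stochastic matrix. -/
def IsStoch (P : Matrix V V ℝ) : Prop :=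
  (∀ i j, 0 ≤ P i j) ∧ ∀ i, ∑ j, P i j = 1

/-- `π` is a probability vector with full support. -/
def IsProb (π : V → ℝ) : Prop := (∀ i, 0 < π i) ∧ ∑ i, π i = 1

/-- reversibility: `π x * P x y = π y * P y x`. -/
def Rev (P : Matrix V V ℝ) (π : V → ℝ) : Prop := ∀ i j, π i * P i j = π j * P j i

/-- irreducibility -/
def Irred (P : Matrix V V ℝ) : Prop := ∀ i j, ∃ t : ℕ, 0 < (P ^ t) i j

/-- the lazy version `(I + P)/2` of a chain -/
def lazyM (P : Matrix V V ℝ) : Matrix V V ℝ := (2 : ℝ)⁻¹ • (1 + P)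

/-- total variation distance -/
def tvDist (μ ν : V → ℝ) : ℝ := (∑ x, |μ x - ν x|) / 2

/-- worst-case total variation distance from stationarity at time `t` -/
def dTV (P : Matrix V V ℝ) (π : V → ℝ) (t : ℕ) : ℝ := ⨆ x, tvDist ((P ^ t) x) π

/-- the `ε` total-variation mixing time -/
def mixTime (P : Matrix V V ℝ) (π : V → ℝ) (ε : ℝ) : ℕ := sInf {t : ℕ | dTV P π t ≤ ε}

/-- worst-case separation distance at time `t` -/
def dSep (P : Matrix V V ℝ) (π : V → ℝ) (t : ℕ) : ℝ := 1 - ⨅ x, ⨅ y, ((P ^ t) x y) / π y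

/-- the `ε` separation time -/
def sepTime (P : Matrix V V ℝ) (π : V → ℝ) (ε : ℝ) : ℕ := sInf {t : ℕ | dSep P π t ≤ ε}

/-- the heat kernel `H_t = exp (t (P - I))` of the associated continuous-time chain -/
def heatKer (P : Matrix V V ℝ) (t : ℝ) : Matrix V V ℝ :=
  ∑' k : ℕ, (t ^ k / (Nat.factorial k : ℝ)) • ((P - 1) ^ k)

/-- separation distance of the continuous-time chain -/
def dSepC (P : Matrix V V ℝ) (π : V → ℝ) (t : ℝ) : ℝ := 1 - ⨅ x, ⨅ y, (heatKer P t) x y / π y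

/-- the `ε` separation time of the continuous-time chain -/
def sepTimeC (P : Matrix V V ℝ) (π : V → ℝ) (ε : ℝ) : ℝ := sInf {t : ℝ | 0 ≤ t ∧ dSepC P π t ≤ ε}

/-- degree of a vertex -/
def deg (G : SimpleGraph V) (v : V) : ℕ := Nat.card {u // G.Adj v u}

open Classical in
/-- transition matrix of the lazy simple random walk on `G` -/
def walkMat (G : SimpleGraph V) : Matrix V V ℝ :=
  Matrix.of fun v u => if v = u then 1/2 else if G.Adj v u then 1 / (2 * (deg G v : ℝ)) else 0

/-- stationary distribution of the (lazy) simple random walk on `G` -/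
def degSta (G : SimpleGraph V) (v : V) : ℝ := (deg G v : ℝ) / ∑ u, (deg G u : ℝ)

/-- the `ε` total-variation mixing time of the lazy simple random walk on `G` -/
def tmixG (G : SimpleGraph V) (ε : ℝ) : ℕ := mixTime (walkMat G) (degSta G) ε

/-- the second largest eigenvalue of a reversible transition matrix -/
def lam2 (P : Matrix V V ℝ) : ℝ :=
  sSup {μ : ℝ | μ ≠ 1 ∧ ∃ f : V → ℝ, f ≠ 0 ∧ P.mulVec f = μ • f}

/-- the relaxation time `1/(1-λ₂)` -/
def trel (P : Matrix V V ℝ) : ℝ := 1 / (1 - lam2 P)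

/-- the relaxation time of the lazy simple random walk on `G` -/
def trelG (G : SimpleGraph V) : ℝ := trel (walkMat G)

/-- transition matrix of the lazy random walk on the network with edge weights `w` -/
def wMat (w : V → V → ℝ) : Matrix V V ℝ :=
  Matrix.of fun v u => if v = u then 1/2 else w v u / (2 * ∑ x, w v x)

/-- stationary distribution of the lazy random walk on the network with edge weights `w` -/
def wSta (w : V → V → ℝ) (v : V) : ℝ := (∑ x, w v x) / ∑ u, ∑ x, w u x

/-- `w` is a valid system of edge weights on the graph `G`: symmetric, positive on edges
and vanishing off the edges. -/
def GoodWeights (G : SimpleGraph V) (w : V → V → ℝ) : Prop :=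
  (∀ u v, w u v = w v u) ∧ (∀ u v, G.Adj u v → 0 < w u v) ∧ ∀ u v, ¬ G.Adj u v → w u v = 0

/-- the `ε` total-variation mixing time of the lazy random walk on the weighted network -/
def tmixW (w : V → V → ℝ) (ε : ℝ) : ℕ := mixTime (wMat w) (wSta w) ε

/-- the probability of a discrete trajectory -/
def pathProb (P : Matrix V V ℝ) {k : ℕ} (w : Fin (k+1) → V) : ℝ :=
  ∏ i : Fin k, P (w i.castSucc) (w i.succ)

/-- `P_x[T_y = k]`: probability that the chain started at `x` first hits `y` at time `k` -/
def firstHit (P : Matrix V V ℝ) (x y : V) (k : ℕ) : ℝ :=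
  ∑ w : Fin (k+1) → V,
    if w 0 = x ∧ w (Fin.last k) = y ∧ ∀ i : Fin k, w i.castSucc ≠ y then pathProb P w else 0

/-- the restriction of `P - I` to the complement of `y` -/
def restrQ (P : Matrix V V ℝ) (y : V) : Matrix {w : V // w ≠ y} {w : V // w ≠ y} ℝ :=
  Matrix.of fun a b => P a.1 b.1 - if a = b then 1 else 0

/-- `exp (t A)` where `A` is the restriction of `P - I` to the complement of `y` -/
def heatRestr (P : Matrix V V ℝ) (y : V) (t : ℝ) :
    Matrix {w : V // w ≠ y} {w : V // w ≠ y} ℝ :=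
  ∑' k : ℕ, (t ^ k / (Nat.factorial k : ℝ)) • (restrQ P y ^ k)

/-- `P_x[T_B < r]` for the chain `P`: the probability that the set `B` is hit before time `r` -/
def hitByTime (P : Matrix V V ℝ) (B : Finset V) (x : V) (r : ℕ) : ℝ :=
  ∑ k ∈ Finset.range r, ∑ w : Fin (k+1) → V,
    if w 0 = x ∧ w (Fin.last k) ∈ B ∧ ∀ i : Fin k, w i.castSucc ∉ B then pathProb P w else 0


open Matrix

set_option linter.unusedSectionVars false

section ReversibleChains

variable {P : Matrix V V ℝ} {π : V → ℝ}

lemma Rev.pow (hR : Rev P π) (t : ℕ) : Rev (P ^ t) π := by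
  induction t with
  | zero =>
    intro i j
    by_cases h : i = j
    · subst h; rfl
    · simp [h, Ne.symm h]
  | succ t ih =>
    intro i j
    rw [pow_succ, Matrix.mul_apply, ← pow_succ, pow_succ', Matrix.mul_apply, Finset.mul_sum,
      Finset.mul_sum]
    refine Finset.sum_congr rfl fun k _ => ?_
    rw [← mul_assoc, ih i k, mul_comm (π k), mul_assoc, hR k j]
    ring

lemma IsStoch.mulVec_one (hP : IsStoch P) (t : ℕ) : (P ^ t) *ᵥ (fun _ => (1 : ℝ)) = fun _ => 1 := by
  induction t with
  | zero => simp
  | succ t ih =>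
    rw [pow_succ', ← Matrix.mulVec_mulVec, ih]
    ext i
    simp [Matrix.mulVec, dotProduct, hP.2 i]

lemma Rev.selfAdjoint (hR : Rev P π) (f g : V → ℝ) :
    ∑ x, π x * (f x * (P *ᵥ g) x) = ∑ x, π x * ((P *ᵥ f) x * g x) := by
  simp only [Matrix.mulVec, dotProduct, Finset.mul_sum, Finset.sum_mul]
  rw [Finset.sum_comm]
  refine Finset.sum_congr rfl fun x _ => Finset.sum_congr rfl fun y _ => ?_
  linear_combination f y * g x * hR y x

lemma Rev.sum_mulVec (hP : IsStoch P) (hR : Rev P π) (f : V → ℝ) :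
    ∑ x, π x * (P *ᵥ f) x = ∑ x, π x * f x := by
  have h := hR.selfAdjoint (fun _ => 1) f
  have h1 := hP.mulVec_one 1
  rw [pow_one] at h1
  simpa [h1] using h

lemma Rev.sum_pow_mulVec (hP : IsStoch P) (hR : Rev P π) (f : V → ℝ) (t : ℕ) :
    ∑ x, π x * ((P ^ t) *ᵥ f) x = ∑ x, π x * f x := by
  induction t with
  | zero => simp
  | succ t ih => rw [pow_succ', ← Matrix.mulVec_mulVec, hR.sum_mulVec hP, ih]

lemma sq_weighted_sum_le {π : V → ℝ} (h : ∀ x, 0 ≤ π x) (f g : V → ℝ) :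
    (∑ x, π x * (f x * g x)) ^ 2 ≤ (∑ x, π x * f x ^ 2) * ∑ x, π x * g x ^ 2 :=
  Finset.sum_sq_le_sum_mul_sum_of_sq_le_mul _ (fun x _ => mul_nonneg (h x) (sq_nonneg _))
    (fun x _ => mul_nonneg (h x) (sq_nonneg _)) (fun x _ => le_of_eq (by ring))

/-- The sequence `‖P^s f‖²` in `L²(π)` is log-convex. -/
lemma Rev.logConvex (hR : Rev P π) (h : ∀ x, 0 ≤ π x) (f : V → ℝ) (s : ℕ) :
    (∑ x, π x * ((P ^ (s + 1)) *ᵥ f) x ^ 2) ^ 2 ≤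
      (∑ x, π x * ((P ^ s) *ᵥ f) x ^ 2) * ∑ x, π x * ((P ^ (s + 2)) *ᵥ f) x ^ 2 := by
  have h1 := hR.selfAdjoint ((P ^ s) *ᵥ f) ((P ^ (s + 1)) *ᵥ f)
  simp only [Matrix.mulVec_mulVec, ← pow_succ'] at h1
  have h2 := sq_weighted_sum_le h ((P ^ s) *ᵥ f) ((P ^ (s + 2)) *ᵥ f)
  rw [h1] at h2
  simpa only [← sq] using h2

/-- A nonnegative log-convex sequence decays at most at its initial rate. -/
lemma pow_mul_le_of_logConvex {b : ℕ → ℝ} (hb : ∀ s, 0 ≤ b s) (h0 : 0 < b 0)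
    (hc : ∀ s, b (s + 1) ^ 2 ≤ b s * b (s + 2)) (s : ℕ) : (b 1 / b 0) ^ s * b 0 ≤ b s := by
  have key : ∀ s, b 1 * b s ≤ b 0 * b (s + 1) := by
    intro s
    induction s with
    | zero => simp [mul_comm]
    | succ s ih =>
      rcases (hb s).eq_or_lt with h | h
      · have h2 := hc s
        rw [← h, zero_mul] at h2
        have h3 : b (s + 1) = 0 := by nlinarith [sq_nonneg (b (s + 1))]
        rw [h3, mul_zero]
        exact mul_nonneg h0.le (hb _)
      · refine le_of_mul_le_mul_left ?_ h
        have h1 := mul_le_mul_of_nonneg_right ih (hb (s + 1))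
        have h2 := mul_le_mul_of_nonneg_left (hc s) h0.le
        show b s * (b 1 * b (s + 1)) ≤ b s * (b 0 * b (s + 2))
        nlinarith
  induction s with
  | zero => simp
  | succ s ih =>
    have h1 : (b 1 / b 0) ^ (s + 1) * b 0 ≤ b 1 / b 0 * b s := by
      rw [pow_succ', mul_assoc]
      exact mul_le_mul_of_nonneg_left ih (div_nonneg (hb 1) h0.le)
    refine h1.trans ?_
    rw [div_mul_eq_mul_div, div_le_iff₀ h0, mul_comm (b (s + 1))]
    exact key s

lemma le_of_pow_le_const_mul_pow {a q M : ℝ} (hq : 0 < q) (h : ∀ k : ℕ, a ^ k ≤ M * q ^ k) :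
    a ≤ q := by
  by_contra! hlt
  have h1 : 1 < a / q := (one_lt_div hq).2 hlt
  obtain ⟨k, hk⟩ := pow_unbounded_of_one_lt M h1
  have h2 := h k
  rw [div_pow, lt_div_iff₀ (pow_pos hq k)] at hk
  linarith

lemma tvDist_le_dTV (P : Matrix V V ℝ) (π : V → ℝ) (t : ℕ) (x : V) :
    tvDist ((P ^ t) x) π ≤ dTV P π t :=
  le_ciSup (f := fun x => tvDist ((P ^ t) x) π) (Set.finite_range _).bddAbove x

/-- Total variation mixing contracts the sup norm of mean zero functions. -/
lemma abs_mulVec_le_of_dTV_le {t : ℕ} (ht : dTV P π t ≤ 1 / 4) {f : V → ℝ} {B : ℝ}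
    (hf : ∑ x, π x * f x = 0) (hB : ∀ x, |f x| ≤ B) (x : V) :
    |((P ^ t) *ᵥ f) x| ≤ B / 2 := by
  have h1 : ((P ^ t) *ᵥ f) x = ∑ y, ((P ^ t) x y - π y) * f y := by
    simp only [sub_mul, Finset.sum_sub_distrib, hf, sub_zero, Matrix.mulVec, dotProduct]
  have h2 := (tvDist_le_dTV P π t x).trans ht
  unfold tvDist at h2
  have hB0 : 0 ≤ B := (abs_nonneg _).trans (hB x)
  calc |((P ^ t) *ᵥ f) x| ≤ ∑ y, |((P ^ t) x y - π y) * f y| := by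
        rw [h1]; exact Finset.abs_sum_le_sum_abs _ _
    _ ≤ ∑ y, |(P ^ t) x y - π y| * B := by
        refine Finset.sum_le_sum fun y _ => ?_
        rw [abs_mul]
        exact mul_le_mul_of_nonneg_left (hB y) (abs_nonneg _)
    _ ≤ B / 2 := by
        rw [← Finset.sum_mul]
        nlinarith

lemma abs_pow_mulVec_le_of_dTV_le (hP : IsStoch P) (hR : Rev P π) {t : ℕ}
    (ht : dTV P π t ≤ 1 / 4) {f : V → ℝ} {B : ℝ} (hf : ∑ x, π x * f x = 0)
    (hB : ∀ x, |f x| ≤ B) (k : ℕ) (x : V) : |((P ^ (t * k)) *ᵥ f) x| ≤ B * (1 / 2) ^ k := by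
  induction k generalizing x with
  | zero => simpa using hB x
  | succ k ih =>
    have h := abs_mulVec_le_of_dTV_le ht ((hR.sum_pow_mulVec hP f (t * k)).trans hf) ih x
    rw [Matrix.mulVec_mulVec, ← pow_add] at h
    rw [mul_add, mul_one, add_comm, pow_succ]
    linarith

/-- A chain that has mixed by time `t` satisfies a Poincaré inequality with constant `2 t`. -/
lemma poincare_of_dTV_le (hP : IsStoch P) (hπ : IsProb π) (hR : Rev P π) {t : ℕ}
    (ht : dTV P π t ≤ 1 / 4) {f : V → ℝ} (hf : ∑ x, π x * f x = 0) :
    ∑ x, π x * f x ^ 2 ≤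
      2 * t * (∑ x, π x * f x ^ 2 - ∑ x, π x * (f x * (P *ᵥ f) x)) := by
  have hπ0 : ∀ x, 0 ≤ π x := fun x => (hπ.1 x).le
  set b : ℕ → ℝ := fun s => ∑ x, π x * ((P ^ s) *ᵥ f) x ^ 2 with hbdef
  have hb : ∀ s, 0 ≤ b s := fun s =>
    Finset.sum_nonneg fun x _ => mul_nonneg (hπ0 x) (sq_nonneg _)
  have hb0 : b 0 = ∑ x, π x * f x ^ 2 := by simp [hbdef]
  have hcs : (∑ x, π x * (f x * (P *ᵥ f) x)) ^ 2 ≤ b 0 * b 1 := by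
    have := sq_weighted_sum_le hπ0 f (P *ᵥ f)
    rw [hb0]
    simpa [hbdef] using this
  rw [← hb0]
  set e := ∑ x, π x * (f x * (P *ᵥ f) x)
  rcases (hb 0).eq_or_lt with h0 | h0
  · rw [← h0] at hcs ⊢
    have : e = 0 := by nlinarith [sq_nonneg e]
    simp [this]
  obtain ⟨B, hB⟩ : ∃ B, ∀ x, |f x| ≤ B := by
    obtain ⟨B, hB⟩ := (Set.finite_range fun x => |f x|).bddAbove
    exact ⟨B, fun x => hB ⟨x, rfl⟩⟩
  set r := b 1 / b 0 with hr
  have hr0 : 0 ≤ r := div_nonneg (hb 1) h0.le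
  have hrt : r ^ t ≤ 1 / 4 := by
    refine le_of_pow_le_const_mul_pow (M := B ^ 2 / b 0) (by norm_num) fun k => ?_
    have h1 := pow_mul_le_of_logConvex hb h0 (fun s => hR.logConvex hπ0 f s) (t * k)
    have h2 : b (t * k) ≤ B ^ 2 * (1 / 4) ^ k := by
      calc b (t * k) ≤ ∑ x, π x * (B ^ 2 * (1 / 4) ^ k) := by
            refine Finset.sum_le_sum fun x _ => mul_le_mul_of_nonneg_left ?_ (hπ0 x)
            have h3 := abs_pow_mulVec_le_of_dTV_le hP hR ht hf hB k x
            have h4 := pow_le_pow_left₀ (abs_nonneg _) h3 2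
            have h5 : ((1 / 2 : ℝ) ^ k) ^ 2 = (1 / 4) ^ k := by
              rw [← pow_mul, mul_comm, pow_mul]; norm_num
            rwa [sq_abs, mul_pow, h5] at h4
        _ = B ^ 2 * (1 / 4) ^ k := by rw [← Finset.sum_mul, hπ.2, one_mul]
    rw [← pow_mul, div_mul_eq_mul_div, le_div_iff₀ h0]
    exact h1.trans h2
  have hs : Real.sqrt r ^ t ≤ 1 / 2 := by
    refine abs_le_of_sq_le_sq' ?_ (by norm_num) |>.2
    rw [← pow_mul, mul_comm, pow_mul, Real.sq_sqrt hr0]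
    norm_num at hrt ⊢
    exact hrt
  have hbern := one_add_mul_le_pow (a := Real.sqrt r - 1)
    (by linarith [Real.sqrt_nonneg r]) t
  rw [add_sub_cancel] at hbern
  have he : e ≤ Real.sqrt r * b 0 := by
    refine abs_le_of_sq_le_sq' ?_ (mul_nonneg (Real.sqrt_nonneg r) h0.le) |>.2
    rw [mul_pow, Real.sq_sqrt hr0, hr]
    refine hcs.trans (le_of_eq ?_)
    field_simp
  have h5 : (t : ℝ) * (b 0 - Real.sqrt r * b 0) ≤ t * (b 0 - e) :=
    mul_le_mul_of_nonneg_left (by linarith) (Nat.cast_nonneg t)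
  have h6 : b 0 * (1 + t * (Real.sqrt r - 1)) ≤ b 0 * (1 / 2) :=
    mul_le_mul_of_nonneg_left (hbern.trans hs) h0.le
  linarith

/-- Exponential `L²` decay from a Poincaré inequality, for nonnegative definite `P`. -/
lemma sum_sq_pow_mulVec_le (hP : IsStoch P) (hR : Rev P π) {γ : ℝ}
    (hpsd : ∀ f : V → ℝ, ∑ x, π x * (P *ᵥ f) x ^ 2 ≤ ∑ x, π x * (f x * (P *ᵥ f) x))
    (hgap : ∀ f : V → ℝ, ∑ x, π x * f x = 0 →
      γ * ∑ x, π x * f x ^ 2 ≤ ∑ x, π x * f x ^ 2 - ∑ x, π x * (f x * (P *ᵥ f) x))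
    (hπ : ∀ x, 0 ≤ π x) {f : V → ℝ} (hf : ∑ x, π x * f x = 0) (t : ℕ) :
    ∑ x, π x * ((P ^ t) *ᵥ f) x ^ 2 ≤ Real.exp (-(γ * t)) * ∑ x, π x * f x ^ 2 := by
  induction t with
  | zero => simp
  | succ t ih =>
    have h1 := hpsd ((P ^ t) *ᵥ f)
    have h2 := hgap ((P ^ t) *ᵥ f) ((hR.sum_pow_mulVec hP f t).trans hf)
    rw [Matrix.mulVec_mulVec, ← pow_succ'] at h1 h2
    have h0 : 0 ≤ ∑ x, π x * ((P ^ t) *ᵥ f) x ^ 2 :=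
      Finset.sum_nonneg fun x _ => mul_nonneg (hπ x) (sq_nonneg _)
    have h3 : 1 - γ ≤ Real.exp (-γ) := by linarith [Real.add_one_le_exp (-γ)]
    have h4 := mul_le_mul_of_nonneg_right h3 h0
    have h5 := mul_le_mul_of_nonneg_left ih (Real.exp_pos (-γ)).le
    rw [← mul_assoc, ← Real.exp_add] at h5
    have h6 : -γ + -(γ * t) = -(γ * (t + 1 : ℕ)) := by push_cast; ring
    rw [h6] at h5
    linarith

lemma tvDist_sq_le (hP : IsStoch P) (hπ : IsProb π) (hR : Rev P π) {γ : ℝ}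
    (hpsd : ∀ f : V → ℝ, ∑ x, π x * (P *ᵥ f) x ^ 2 ≤ ∑ x, π x * (f x * (P *ᵥ f) x))
    (hgap : ∀ f : V → ℝ, ∑ x, π x * f x = 0 →
      γ * ∑ x, π x * f x ^ 2 ≤ ∑ x, π x * f x ^ 2 - ∑ x, π x * (f x * (P *ᵥ f) x))
    (t : ℕ) (x : V) :
    (2 * tvDist ((P ^ t) x) π) ^ 2 ≤ Real.exp (-(γ * t)) / π x := by
  have hπ0 : ∀ x, 0 ≤ π x := fun x => (hπ.1 x).le
  have hx := hπ.1 x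
  set f : V → ℝ := Pi.single x (π x)⁻¹ - fun _ => 1 with hfdef
  have hf : ∑ y, π y * f y = 0 := by
    simp [hfdef, mul_sub, Finset.sum_sub_distrib, hπ.2, Pi.single_apply, hx.ne']
  have hfsq : ∑ y, π y * f y ^ 2 ≤ 1 / π x := by
    have h1 : ∀ y, π y * f y ^ 2 =
        (if y = x then (π x)⁻¹ else 0) - 2 * (if y = x then 1 else 0) + π y := by
      intro y
      by_cases h : y = x
      · subst h
        simp [hfdef]
        field_simp
        ring
      · simp [hfdef, h]
    rw [Finset.sum_congr rfl fun y _ => h1 y]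
    simp only [Finset.sum_add_distrib, Finset.sum_sub_distrib, hπ.2, ← Finset.mul_sum,
      Finset.sum_ite_eq', Finset.mem_univ, if_true, one_div]
    linarith
  have hpow : ∀ y, π y * ((P ^ t) *ᵥ f) y = (P ^ t) x y - π y := by
    intro y
    rw [hfdef, Matrix.mulVec_sub, hP.mulVec_one t, Pi.sub_apply, Matrix.mulVec_single]
    have h := hR.pow t y x
    simp only [Pi.smul_apply, Matrix.col_apply, MulOpposite.smul_eq_mul_unop,
      MulOpposite.unop_op]
    field_simp
    linear_combination h
  have h1 : 2 * tvDist ((P ^ t) x) π = ∑ y, π y * (1 * |((P ^ t) *ᵥ f) y|) := by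
    unfold tvDist
    rw [mul_div_cancel₀ _ two_ne_zero]
    refine Finset.sum_congr rfl fun y _ => ?_
    rw [← hpow y, abs_mul, abs_of_pos (hπ.1 y), one_mul]
  have h2 := sq_weighted_sum_le hπ0 (fun _ => 1) (fun y => |((P ^ t) *ᵥ f) y|)
  simp only [one_pow, mul_one, hπ.2, one_mul, sq_abs] at h2
  rw [h1]
  simp only [one_mul]
  refine h2.trans ((sum_sq_pow_mulVec_le hP hR hpsd hgap hπ0 hf t).trans ?_)
  rw [div_eq_mul_one_div]
  exact mul_le_mul_of_nonneg_left hfsq (Real.exp_pos _).le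

lemma dTV_le_of_gap [Nonempty V] (hP : IsStoch P) (hπ : IsProb π) (hR : Rev P π) {γ M : ℝ}
    (hpsd : ∀ f : V → ℝ, ∑ x, π x * (P *ᵥ f) x ^ 2 ≤ ∑ x, π x * (f x * (P *ᵥ f) x))
    (hgap : ∀ f : V → ℝ, ∑ x, π x * f x = 0 →
      γ * ∑ x, π x * f x ^ 2 ≤ ∑ x, π x * f x ^ 2 - ∑ x, π x * (f x * (P *ᵥ f) x))
    (hM : 0 < M) (hπM : ∀ x, 1 / M ≤ π x) {t : ℕ} (ht : Real.log (4 * M) ≤ γ * t) :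
    dTV P π t ≤ 1 / 4 := by
  refine ciSup_le fun x => ?_
  have h1 := tvDist_sq_le hP hπ hR hpsd hgap t x
  have h2 : Real.exp (-(γ * t)) ≤ 1 / (4 * M) := by
    rw [Real.exp_neg, ← one_div]
    refine one_div_le_one_div_of_le (by positivity) ?_
    rw [← Real.log_le_iff_le_exp (by positivity)]
    exact ht
  have h3 : Real.exp (-(γ * t)) / π x ≤ 1 / 4 := by
    rw [div_le_iff₀ (hπ.1 x)]
    refine h2.trans ?_
    have := hπM x
    calc 1 / (4 * M) = 1 / 4 * (1 / M) := by field_simp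
      _ ≤ 1 / 4 * π x := by linarith
  have h4 : 0 ≤ tvDist ((P ^ t) x) π := by unfold tvDist; positivity
  nlinarith

end ReversibleChains

section Networks

variable {w : V → V → ℝ}

/-- The total weight at a vertex. -/
def mass (w : V → V → ℝ) (v : V) : ℝ := ∑ x, w v x

/-- The (unnormalised) Dirichlet energy of the network `w`. -/
def energy (w : V → V → ℝ) (f : V → ℝ) : ℝ := ∑ x, ∑ y, w x y * (f x - f y) ^ 2

/-- The network `w` satisfies a Poincaré inequality with constant `A`. -/
def Poincare (w : V → V → ℝ) (A : ℝ) : Prop :=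
  ∀ f : V → ℝ, ∃ c : ℝ, ∑ x, mass w x * (f x - c) ^ 2 ≤ A * energy w f

/-- Symmetric nonnegative loopless weights, positive in total at every vertex. -/
structure IsNetwork (w : V → V → ℝ) : Prop where
  symm : ∀ u v, w u v = w v u
  nonneg : ∀ u v, 0 ≤ w u v
  loopless : ∀ v, w v v = 0
  mass_pos : ∀ v, 0 < mass w v

lemma wSta_eq (w : V → V → ℝ) (v : V) : wSta w v = mass w v / ∑ u, mass w u := rfl

lemma wMat_apply (h : IsNetwork w) (v u : V) :
    wMat w v u = (if v = u then 1 / 2 else 0) + w v u / (2 * mass w v) := by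
  by_cases hvu : v = u
  · subst hvu; simp [wMat, h.loopless]
  · simp [wMat, hvu, mass]

lemma IsNetwork.isStoch (h : IsNetwork w) : IsStoch (wMat w) := by
  constructor
  · intro i j
    rw [wMat_apply h]
    have h1 := h.nonneg i j
    have h2 := h.mass_pos i
    split_ifs <;> positivity
  · intro i
    simp only [wMat_apply h, Finset.sum_add_distrib, ← Finset.sum_div]
    have h2 := (h.mass_pos i).ne'
    have h3 : ∑ x, w i x = mass w i := rfl
    simp [h3]
    field_simp
    norm_num

lemma IsNetwork.total_pos [Nonempty V] (h : IsNetwork w) : 0 < ∑ u, mass w u :=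
  Finset.sum_pos (fun v _ => h.mass_pos v) Finset.univ_nonempty

lemma IsNetwork.isProb [Nonempty V] (h : IsNetwork w) : IsProb (wSta w) := by
  refine ⟨fun v => div_pos (h.mass_pos v) h.total_pos, ?_⟩
  simp only [wSta_eq, ← Finset.sum_div]
  exact div_self h.total_pos.ne'

lemma IsNetwork.rev (h : IsNetwork w) : Rev (wMat w) (wSta w) := by
  intro i j
  by_cases hij : i = j
  · subst hij; rfl
  · have h1 := (h.mass_pos i).ne'
    have h2 := (h.mass_pos j).ne'
    rw [wMat_apply h, wMat_apply h, if_neg hij, if_neg (Ne.symm hij), wSta_eq, wSta_eq,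
      h.symm j i, zero_add, zero_add]
    by_cases h3 : ∑ u, mass w u = 0
    · simp [h3]
    · field_simp

lemma mulVec_wMat (h : IsNetwork w) (f : V → ℝ) (x : V) :
    (wMat w *ᵥ f) x = (f x + (∑ y, w x y * f y) / mass w x) / 2 := by
  have h1 := (h.mass_pos x).ne'
  simp only [Matrix.mulVec, dotProduct, wMat_apply h, add_mul, Finset.sum_add_distrib]
  have h2 : ∑ y, w x y / (2 * mass w x) * f y = (∑ y, w x y * f y) / (2 * mass w x) := by
    rw [Finset.sum_div]
    exact Finset.sum_congr rfl fun y _ => by ring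
  rw [h2]
  simp
  field_simp

lemma sum_wSta_mul (w : V → V → ℝ) (g : V → ℝ) :
    ∑ x, wSta w x * g x = (∑ x, mass w x * g x) / ∑ u, mass w u := by
  rw [Finset.sum_div]
  exact Finset.sum_congr rfl fun x _ => by rw [wSta_eq]; ring

lemma energy_eq (h : IsNetwork w) (f : V → ℝ) :
    energy w f = 2 * (∑ x, mass w x * f x ^ 2 - ∑ x, f x * ∑ y, w x y * f y) := by
  have h1 : ∑ x, ∑ y, w x y * f y ^ 2 = ∑ x, mass w x * f x ^ 2 := by
    rw [Finset.sum_comm]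
    refine Finset.sum_congr rfl fun x _ => ?_
    rw [mass, Finset.sum_mul]
    exact Finset.sum_congr rfl fun y _ => by rw [h.symm]
  have h2 : ∑ x, ∑ y, w x y * f x ^ 2 = ∑ x, mass w x * f x ^ 2 :=
    Finset.sum_congr rfl fun x _ => by rw [mass, Finset.sum_mul]
  have h3 : energy w f = ∑ x, ∑ y, w x y * f x ^ 2 + ∑ x, ∑ y, w x y * f y ^ 2 -
      2 * ∑ x, f x * ∑ y, w x y * f y := by
    simp only [energy, Finset.mul_sum, ← Finset.sum_add_distrib, ← Finset.sum_sub_distrib]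
    exact Finset.sum_congr rfl fun x _ => Finset.sum_congr rfl fun y _ => by ring
  rw [h3, h1, h2]
  ring

lemma dirichlet_eq_energy (h : IsNetwork w) (f : V → ℝ) :
    ∑ x, wSta w x * f x ^ 2 - ∑ x, wSta w x * (f x * (wMat w *ᵥ f) x) =
      energy w f / 4 / ∑ u, mass w u := by
  rw [sum_wSta_mul, sum_wSta_mul, ← sub_div, energy_eq h]
  congr 1
  have h1 : ∀ x, mass w x * (f x * (wMat w *ᵥ f) x) =
      (mass w x * f x ^ 2 + f x * ∑ y, w x y * f y) / 2 := by
    intro x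
    have := (h.mass_pos x).ne'
    rw [mulVec_wMat h]
    field_simp
  rw [Finset.sum_congr rfl fun x _ => h1 x, ← Finset.sum_div, Finset.sum_add_distrib]
  ring

/-- Laziness makes the transition operator nonnegative definite. -/
lemma sum_sq_mulVec_wMat_le (h : IsNetwork w) (f : V → ℝ) :
    ∑ x, wSta w x * (wMat w *ᵥ f) x ^ 2 ≤ ∑ x, wSta w x * (f x * (wMat w *ᵥ f) x) := by
  rw [sum_wSta_mul, sum_wSta_mul]
  refine div_le_div_of_nonneg_right ?_ (Finset.sum_nonneg fun v _ => (h.mass_pos v).le)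
  have h1 : ∑ x, (∑ y, w x y * f y) ^ 2 / mass w x ≤ ∑ x, mass w x * f x ^ 2 := by
    calc ∑ x, (∑ y, w x y * f y) ^ 2 / mass w x ≤ ∑ x, ∑ y, w x y * f y ^ 2 := by
          refine Finset.sum_le_sum fun x _ => ?_
          rw [div_le_iff₀ (h.mass_pos x), mul_comm]
          have := sq_weighted_sum_le (h.nonneg x) (fun _ => 1) f
          simpa [mass] using this
      _ = ∑ x, mass w x * f x ^ 2 := by
          rw [Finset.sum_comm]
          refine Finset.sum_congr rfl fun x _ => ?_
          rw [mass, Finset.sum_mul]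
          exact Finset.sum_congr rfl fun y _ => by rw [h.symm]
  have h2 : ∑ x, mass w x * (f x * (wMat w *ᵥ f) x) - ∑ x, mass w x * (wMat w *ᵥ f) x ^ 2 =
      (∑ x, mass w x * f x ^ 2 - ∑ x, (∑ y, w x y * f y) ^ 2 / mass w x) / 4 := by
    rw [← Finset.sum_sub_distrib, ← Finset.sum_sub_distrib, Finset.sum_div]
    refine Finset.sum_congr rfl fun x _ => ?_
    have := (h.mass_pos x).ne'
    rw [mulVec_wMat h]
    field_simp
    ring
  linarith

lemma poincare_of_mixed [Nonempty V] (h : IsNetwork w) {t : ℕ}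
    (ht : dTV (wMat w) (wSta w) t ≤ 1 / 4) : Poincare w (t / 2) := by
  intro f
  have hZ := h.total_pos
  set c := ∑ x, wSta w x * f x with hc
  have hmean : ∑ x, wSta w x * (f x - c) = 0 := by
    simp only [mul_sub, Finset.sum_sub_distrib, ← Finset.sum_mul, h.isProb.2, one_mul]
    rw [← hc, sub_self]
  refine ⟨c, ?_⟩
  have h1 := poincare_of_dTV_le h.isStoch h.isProb h.rev ht (f := fun x => f x - c) hmean
  rw [dirichlet_eq_energy h, sum_wSta_mul, ← mul_div_assoc,
    div_le_div_iff_of_pos_right hZ] at h1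
  have h2 : energy w (fun x => f x - c) = energy w f := by simp [energy]
  rw [h2] at h1
  linarith

lemma Poincare.mixed [Nonempty V] (h : IsNetwork w) {A M : ℝ} (hA : 0 < A)
    (hp : Poincare w A) (hM : 0 < M) (hπM : ∀ x, 1 / M ≤ wSta w x) {t : ℕ}
    (ht : 4 * A * Real.log (4 * M) ≤ t) : dTV (wMat w) (wSta w) t ≤ 1 / 4 := by
  refine dTV_le_of_gap (γ := 1 / (4 * A)) h.isStoch h.isProb h.rev (sum_sq_mulVec_wMat_le h)
    (fun f hf => ?_) hM hπM ?_
  · obtain ⟨c, hc⟩ := hp f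
    have hZ := h.total_pos
    rw [dirichlet_eq_energy h, sum_wSta_mul, ← mul_div_assoc, div_le_div_iff_of_pos_right hZ]
    rw [sum_wSta_mul, div_eq_zero_iff, or_iff_left hZ.ne'] at hf
    have h1 : ∑ x, mass w x * (f x - c) ^ 2 = ∑ x, mass w x * f x ^ 2 -
        2 * c * ∑ x, mass w x * f x + c ^ 2 * ∑ x, mass w x := by
      simp only [Finset.mul_sum, ← Finset.sum_add_distrib, ← Finset.sum_sub_distrib]
      exact Finset.sum_congr rfl fun x _ => by ring
    rw [hf] at h1
    have h2 : 0 ≤ c ^ 2 * ∑ x, mass w x := by positivity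
    rw [one_div, inv_mul_le_iff₀ (by positivity)]
    linarith
  · rw [one_div, inv_mul_eq_div, le_div_iff₀ (by positivity)]
    linarith

/-- Poincaré inequalities are stable under bounded perturbations of the weights. -/
lemma Poincare.perturb {w' : V → V → ℝ} {A L : ℝ} (hA : 0 ≤ A) (hL : 0 ≤ L)
    (hp : Poincare w' A) (h1 : ∀ u v, w u v ≤ L * w' u v) (h2 : ∀ u v, w' u v ≤ L * w u v) :
    Poincare w (L ^ 2 * A) := by
  intro f
  obtain ⟨c, hc⟩ := hp f
  refine ⟨c, ?_⟩
  have hm : ∀ x, mass w x ≤ L * mass w' x := fun x => by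
    rw [mass, mass, Finset.mul_sum]
    exact Finset.sum_le_sum fun y _ => h1 x y
  have he : energy w' f ≤ L * energy w f := by
    simp only [energy, Finset.mul_sum]
    refine Finset.sum_le_sum fun x _ => Finset.sum_le_sum fun y _ => ?_
    rw [← mul_assoc]
    exact mul_le_mul_of_nonneg_right (h2 x y) (sq_nonneg _)
  calc ∑ x, mass w x * (f x - c) ^ 2 ≤ ∑ x, L * (mass w' x * (f x - c) ^ 2) := by
        refine Finset.sum_le_sum fun x _ => ?_
        rw [← mul_assoc]
        exact mul_le_mul_of_nonneg_right (hm x) (sq_nonneg _)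
    _ ≤ L * (A * (L * energy w f)) := by
        rw [← Finset.mul_sum]
        exact mul_le_mul_of_nonneg_left (hc.trans (mul_le_mul_of_nonneg_left he hA)) hL
    _ = L ^ 2 * A * energy w f := by ring

lemma not_poincare_zero [Nontrivial V] (h : IsNetwork w) : ¬ Poincare w 0 := by
  intro hp
  obtain ⟨a, b, hab⟩ := exists_pair_ne V
  obtain ⟨c, hc⟩ := hp (Pi.single a 1)
  rw [zero_mul] at hc
  have hnn : ∀ x ∈ Finset.univ, 0 ≤ mass w x * ((Pi.single a 1 : V → ℝ) x - c) ^ 2 :=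
    fun x _ => mul_nonneg (h.mass_pos x).le (sq_nonneg _)
  have h0 := (Finset.sum_eq_zero_iff_of_nonneg hnn).1 (le_antisymm hc (Finset.sum_nonneg hnn))
  have ha := h0 a (Finset.mem_univ _)
  have hb := h0 b (Finset.mem_univ _)
  simp only [mul_eq_zero, (h.mass_pos _).ne', false_or, pow_eq_zero_iff two_ne_zero,
    Pi.single_eq_same, Pi.single_eq_of_ne hab.symm] at ha hb
  linarith

end Networks

section BoundedWeights

variable {G : SimpleGraph V} {K : ℝ} {w w' : V → V → ℝ}

/-- Edge weights on `G` with values in `[K⁻¹, K]`. -/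
structure BddWeights (G : SimpleGraph V) (K : ℝ) (w : V → V → ℝ) : Prop where
  symm : ∀ u v, w u v = w v u
  off : ∀ u v, ¬ G.Adj u v → w u v = 0
  bdd : ∀ u v, G.Adj u v → K⁻¹ ≤ w u v ∧ w u v ≤ K

lemma BddWeights.nonneg (hK : 1 ≤ K) (h : BddWeights G K w) (u v : V) : 0 ≤ w u v := by
  by_cases ha : G.Adj u v
  · exact (inv_nonneg.2 (zero_le_one.trans hK)).trans (h.bdd u v ha).1
  · exact (h.off u v ha).ge

lemma BddWeights.inv_le_mass [Nontrivial V] (hK : 1 ≤ K) (hG : G.Connected)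
    (h : BddWeights G K w) (v : V) : K⁻¹ ≤ mass w v := by
  obtain ⟨u, hu⟩ := hG.preconnected.exists_adj_of_nontrivial v
  exact (h.bdd v u hu).1.trans
    (Finset.single_le_sum (f := w v) (fun x _ => h.nonneg hK v x) (Finset.mem_univ u))

lemma BddWeights.isNetwork [Nontrivial V] (hK : 1 ≤ K) (hG : G.Connected)
    (h : BddWeights G K w) : IsNetwork w where
  symm := h.symm
  nonneg := h.nonneg hK
  loopless v := h.off v v (G.irrefl)
  mass_pos v := (inv_pos.2 (zero_lt_one.trans_le hK)).trans_le (h.inv_le_mass hK hG v)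

open Classical in
lemma deg_eq_sum (G : SimpleGraph V) (v : V) :
    (deg G v : ℝ) = ∑ x, if G.Adj v x then (1 : ℝ) else 0 := by
  rw [Finset.sum_boole, deg, Nat.card_eq_fintype_card, Fintype.card_subtype]

lemma BddWeights.mass_le (h : BddWeights G K w) (v : V) :
    mass w v ≤ deg G v * K := by
  classical
  rw [deg_eq_sum, Finset.sum_mul, mass]
  refine Finset.sum_le_sum fun x _ => ?_
  by_cases ha : G.Adj v x
  · simpa [ha] using (h.bdd v x ha).2
  · simp [ha, h.off v x ha]

lemma BddWeights.le_wSta [Nontrivial V] (hK : 1 ≤ K) (hG : G.Connected) {D : ℕ}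
    (hD : ∀ v, deg G v ≤ D) (h : BddWeights G K w) (v : V) :
    1 / (Fintype.card V * D * K ^ 2) ≤ wSta w v := by
  have hK0 : 0 < K := zero_lt_one.trans_le hK
  have hZ : ∑ u, mass w u ≤ Fintype.card V * D * K := by
    calc ∑ u, mass w u ≤ ∑ _u : V, D * K := by
          refine Finset.sum_le_sum fun u _ => (h.mass_le u).trans ?_
          exact mul_le_mul_of_nonneg_right (by exact_mod_cast hD u) hK0.le
      _ = Fintype.card V * D * K := by simp [mul_assoc]
  have hZ0 := (h.isNetwork hK hG).total_pos
  calc 1 / (Fintype.card V * D * K ^ 2) = K⁻¹ / (Fintype.card V * D * K) := by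
        rw [one_div, inv_eq_one_div K, div_div, ← one_div]; ring_nf
    _ ≤ mass w v / ∑ u, mass w u :=
        div_le_div₀ ((h.isNetwork hK hG).mass_pos v).le (h.inv_le_mass hK hG v) hZ0 hZ

lemma BddWeights.le_mul (hK : 1 ≤ K) (h : BddWeights G K w) (h' : BddWeights G K w') (u v : V) :
    w u v ≤ K ^ 2 * w' u v := by
  have hK0 : 0 < K := zero_lt_one.trans_le hK
  by_cases ha : G.Adj u v
  · calc w u v ≤ K := (h.bdd u v ha).2
      _ = K ^ 2 * K⁻¹ := by field_simp
      _ ≤ K ^ 2 * w' u v := mul_le_mul_of_nonneg_left (h'.bdd u v ha).1 (sq_nonneg K)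
  · simp [h.off u v ha, h'.off u v ha]

/-- A connected finite network satisfies some Poincaré inequality. -/
lemma BddWeights.exists_poincare [Nontrivial V] (hK : 1 ≤ K) (hG : G.Connected)
    (h : BddWeights G K w) : ∃ A, 0 < A ∧ Poincare w A := by
  have hK0 : 0 < K := zero_lt_one.trans_le hK
  have hw := h.isNetwork hK hG
  have hen : ∀ f, 0 ≤ energy w f := fun f =>
    Finset.sum_nonneg fun x _ => Finset.sum_nonneg fun y _ =>
      mul_nonneg (hw.nonneg x y) (sq_nonneg _)
  have hedge : ∀ f u v, G.Adj u v → |f u - f v| ≤ Real.sqrt (K * energy w f) := by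
    intro f u v ha
    refine Real.abs_le_sqrt ?_
    have h1 : w u v * (f u - f v) ^ 2 ≤ energy w f := by
      refine (Finset.single_le_sum (f := fun y => w u y * (f u - f y) ^ 2)
        (fun y _ => mul_nonneg (hw.nonneg u y) (sq_nonneg _)) (Finset.mem_univ v)).trans ?_
      exact Finset.single_le_sum (f := fun x => ∑ y, w x y * (f x - f y) ^ 2)
        (fun x _ => Finset.sum_nonneg fun y _ => mul_nonneg (hw.nonneg x y) (sq_nonneg _))
        (Finset.mem_univ u)
    have h2 := mul_le_mul_of_nonneg_right (h.bdd u v ha).1 (sq_nonneg (f u - f v))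
    exact (inv_mul_le_iff₀ hK0).1 (h2.trans h1)
  have hwalk : ∀ (f : V → ℝ) (u v : V) (p : G.Walk u v),
      |f u - f v| ≤ p.length * Real.sqrt (K * energy w f) := by
    intro f u v p
    induction p with
    | nil => simp
    | @cons a b c ha p ih =>
      have h1 := abs_sub_le (f a) (f b) (f c)
      have h2 := hedge f a b ha
      rw [SimpleGraph.Walk.length_cons]
      push_cast
      linarith
  have hn : (0 : ℝ) < Fintype.card V := by exact_mod_cast Fintype.card_pos
  have hZ := hw.total_pos
  refine ⟨(∑ x, mass w x) * ((Fintype.card V : ℝ) ^ 2 * K), by positivity, fun f => ?_⟩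
  let o : V := Classical.arbitrary V
  refine ⟨f o, ?_⟩
  rw [mul_assoc, Finset.sum_mul]
  refine Finset.sum_le_sum fun x _ => mul_le_mul_of_nonneg_left ?_ (hw.mass_pos x).le
  obtain ⟨p, hp⟩ := hG.preconnected.exists_isPath x o
  have h1 := hwalk f x o p
  have h2 : (p.length : ℝ) ≤ Fintype.card V := by exact_mod_cast hp.length_lt.le
  have h3 := h1.trans (mul_le_mul_of_nonneg_right h2 (Real.sqrt_nonneg _))
  have h4 := pow_le_pow_left₀ (abs_nonneg _) h3 2
  rw [sq_abs, mul_pow, Real.sq_sqrt (mul_nonneg hK0.le (hen f))] at h4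
  rwa [mul_assoc]

lemma dTV_mixTime_le {P : Matrix V V ℝ} {π : V → ℝ} {ε : ℝ} {t : ℕ} (h : dTV P π t ≤ ε) :
    dTV P π (mixTime P π ε) ≤ ε :=
  Nat.sInf_mem (s := {t : ℕ | dTV P π t ≤ ε}) ⟨t, h⟩

lemma BddWeights.poincare_tmixW [Nontrivial V] (hK : 1 ≤ K) (hG : G.Connected)
    (h : BddWeights G K w) : Poincare w (tmixW w (1 / 4) / 2) := by
  have hw := h.isNetwork hK hG
  obtain ⟨A, hA, hp⟩ := h.exists_poincare hK hG
  have hsum := (h.isNetwork hK hG).total_pos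
  obtain ⟨t, ht⟩ := exists_nat_ge (4 * A * Real.log (4 * ((∑ u, mass w u) * K)))
  have hK0 : 0 < K := zero_lt_one.trans_le hK
  refine poincare_of_mixed hw (dTV_mixTime_le (hp.mixed hw hA (by positivity) (fun x => ?_) ht))
  rw [wSta_eq, mul_comm, ← div_div, one_div]
  exact div_le_div_of_nonneg_right (h.inv_le_mass hK hG x) hsum.le

lemma BddWeights.one_le_tmixW [Nontrivial V] (hK : 1 ≤ K) (hG : G.Connected)
    (h : BddWeights G K w) : 1 ≤ tmixW w (1 / 4) := by
  by_contra! h0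
  have hp := h.poincare_tmixW hK hG
  rw [Nat.lt_one_iff.1 h0, Nat.cast_zero, zero_div] at hp
  exact not_poincare_zero (h.isNetwork hK hG) hp

/-- The mixing times of two bounded networks on `G` differ by at most a logarithmic factor. -/
lemma BddWeights.tmixW_le [Nontrivial V] (hK : 1 ≤ K) (hG : G.Connected) {D : ℕ} (hD1 : 1 ≤ D)
    (hD : ∀ v, deg G v ≤ D) (hcard : 3 ≤ Fintype.card V)
    (h : BddWeights G K w) (h' : BddWeights G K w') :
    (tmixW w (1 / 4) : ℝ) ≤ (2 * K ^ 4 * (1 + Real.log (4 * (D * K ^ 2))) + 1) *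
      Real.log (Fintype.card V) * tmixW w' (1 / 4) := by
  have hK0 : 0 < K := zero_lt_one.trans_le hK
  have ht' : (1 : ℝ) ≤ tmixW w' (1 / 4) := by exact_mod_cast h'.one_le_tmixW hK hG
  set t' : ℝ := (tmixW w' (1 / 4) : ℝ) with ht'def
  have hN : (3 : ℝ) ≤ Fintype.card V := by exact_mod_cast hcard
  have hDr : (1 : ℝ) ≤ D := by exact_mod_cast hD1
  set n : ℝ := (Fintype.card V : ℝ) with hn
  have hlogN : 1 ≤ Real.log n := by
    rw [Real.le_log_iff_exp_le (by linarith)]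
    linarith [Real.exp_one_lt_d9]
  have hDK : 1 ≤ 4 * ((D : ℝ) * K ^ 2) := by
    have : 1 ≤ K ^ 2 := one_le_pow₀ hK
    nlinarith
  have hlogD : 0 ≤ Real.log (4 * (D * K ^ 2)) := Real.log_nonneg hDK
  have hp := (h'.poincare_tmixW hK hG).perturb (by positivity) (sq_nonneg K)
    (h.le_mul hK h') (h'.le_mul hK h)
  have hlog : Real.log (4 * (n * D * K ^ 2)) = Real.log n + Real.log (4 * (D * K ^ 2)) := by
    rw [← Real.log_mul (by linarith) (by linarith)]
    ring_nf
  have hmix := hp.mixed (h.isNetwork hK hG) (by positivity) (M := n * D * K ^ 2)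
    (by positivity) (h.le_wSta hK hG hD) (Nat.le_ceil _)
  have hle : (tmixW w (1 / 4) : ℝ) ≤ _ := Nat.cast_le.2 (Nat.sInf_le hmix)
  refine hle.trans ((Nat.ceil_lt_add_one ?_).le.trans ?_)
  · rw [hlog]; positivity
  · rw [hlog]
    have h1 : Real.log n + Real.log (4 * (D * K ^ 2)) ≤
        (1 + Real.log (4 * (D * K ^ 2))) * Real.log n := by nlinarith
    have h2 : 1 ≤ Real.log n * t' := one_le_mul_of_one_le_of_one_le hlogN ht'
    have h3 : 0 ≤ 2 * K ^ 4 * t' := by positivity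
    have h4 := mul_le_mul_of_nonneg_left h1 h3
    linarith

end BoundedWeights

open Classical in
/-- The unit weights on the edges of `G`. -/
def unitWeights (G : SimpleGraph V) (u v : V) : ℝ := if G.Adj u v then 1 else 0

lemma unitWeights_bdd (G : SimpleGraph V) {K : ℝ} (hK : 1 ≤ K) :
    BddWeights G K (unitWeights G) where
  symm u v := by rw [unitWeights, unitWeights, G.adj_comm]
  off u v h := by simp [unitWeights, h]
  bdd u v h := by simpa [unitWeights, h] using ⟨inv_le_one_of_one_le₀ hK, hK⟩

lemma tmixW_unitWeights (G : SimpleGraph V) (ε : ℝ) : tmixW (unitWeights G) ε = tmixG G ε := by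
  have hm : ∀ v, ∑ x, unitWeights G v x = deg G v := fun v => (deg_eq_sum G v).symm
  have h1 : wMat (unitWeights G) = walkMat G := by
    ext v u
    simp only [wMat, walkMat, hm, Matrix.of_apply]
    simp only [unitWeights, ite_div, zero_div]
  have h2 : wSta (unitWeights G) = degSta G := by
    ext v
    simp only [wSta, degSta, hm]
  rw [tmixW, tmixG, h1, h2]

/-- **Remark 1.9 / Eq. (1.4).** For every maximal degree `D` and every `K ≥ 1` there is a
constant `C = C(D,K)` such that a `K`-bounded perturbation of the edge weights of a bounded
degree graph can change the mixing time by a factor of at most `C log |V|`. -/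
theorem bounded_perturbation_changes_mixing_by_at_most_log
    (D : ℕ) (K : ℝ) (hK : 1 ≤ K) :
    ∃ C : ℝ, 0 < C ∧
      ∀ (N : ℕ) (G : SimpleGraph (Fin N)), 3 ≤ N → G.Connected →
        (∀ v, deg G v ≤ D) →
        ∀ w : Fin N → Fin N → ℝ,
          (∀ u v, w u v = w v u) →
          (∀ u v, ¬ G.Adj u v → w u v = 0) →
          (∀ u v, G.Adj u v → K⁻¹ ≤ w u v ∧ w u v ≤ K) →
          1 / (C * Real.log N) ≤ (tmixW w (1/4) : ℝ) / (tmixG G (1/4) : ℝ) ∧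
          (tmixW w (1/4) : ℝ) / (tmixG G (1/4) : ℝ) ≤ C * Real.log N := by
  have hK0 : 0 < K := zero_lt_one.trans_le hK
  have hmax : (1 : ℝ) ≤ (max D 1 : ℕ) := by exact_mod_cast le_max_right D 1
  have hK2 : 1 ≤ K ^ 2 := one_le_pow₀ hK
  have hlog : 0 ≤ Real.log (4 * ((max D 1 : ℕ) * K ^ 2)) := Real.log_nonneg (by nlinarith)
  have hC : 0 < 2 * K ^ 4 * (1 + Real.log (4 * ((max D 1 : ℕ) * K ^ 2))) + 1 := by positivity
  refine ⟨_, hC, fun N G hN hG hD w hsymm hoff hbdd => ?_⟩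
  have : Nontrivial (Fin N) := Fin.nontrivial_iff_two_le.2 (by omega)
  have hw : BddWeights G K w := ⟨hsymm, hoff, hbdd⟩
  have hu := unitWeights_bdd G hK
  have hD' : ∀ v, deg G v ≤ max D 1 := fun v => (hD v).trans (le_max_left _ _)
  have hcard : 3 ≤ Fintype.card (Fin N) := by simpa using hN
  have h1 := hw.tmixW_le hK hG (le_max_right D 1) hD' hcard hu
  have h2 := hu.tmixW_le hK hG (le_max_right D 1) hD' hcard hw
  have hp1 : (0 : ℝ) < tmixW w (1 / 4) := by exact_mod_cast hw.one_le_tmixW hK hG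
  have hp2 : (0 : ℝ) < tmixG G (1 / 4) := by
    rw [← tmixW_unitWeights]
    exact_mod_cast hu.one_le_tmixW hK hG
  rw [tmixW_unitWeights, Fintype.card_fin] at h1 h2
  have hN1 : 0 < Real.log N := Real.log_pos (by exact_mod_cast (by omega : 1 < N))
  refine ⟨?_, (div_le_iff₀ hp2).2 h1⟩
  rw [div_le_div_iff₀ (mul_pos hC hN1) hp2, one_mul, mul_comm]
  exact h2

end
end

section
/- Let (Ω,P,π) be a finite irreducible reversible Markov chain with lazy version P_L := (I+P)/2, and let x,y,z ∈ Ω be such that every path from x to y in the transition graph passes through z (i.e. for every k ∈ ℕ and every sequence x = w_0, w_1, …, w_k = y with P(w_i, w_{i+1}) > 0 for all i, some w_i equals z). Then for every t ∈ ℕ, P_L^t(x,y)/π(y) = Σ_{k=0}^{t} P[T_z^{x,y} = k]·P_L^{t−k}(z,z)/π(z). -/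
open Filter Finset

noncomputable section

variable {V : Type} [Fintype V] [DecidableEq V]

/-- `P[T_z^{x,y} = k]` where `T_z^{x,y} = T_z^x + T_z^y` is the sum of the hitting times of
`z` of two independent copies of the chain, started at `x` and at `y`. -/
def probDoubleHit (P : Matrix V V ℝ) (x y z : V) (k : ℕ) : ℝ :=
  ∑ j ∈ Finset.range (k+1), firstHit P x z j * firstHit P y z (k - j)

omit [Fintype V] [DecidableEq V] in
lemma pathProb_cons (P : Matrix V V ℝ) {k : ℕ} (a : V) (w : Fin (k + 1) → V) :
    pathProb P (Fin.cons a w : Fin (k + 1 + 1) → V) = P a (w 0) * pathProb P w := by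
  simp [pathProb, Fin.prod_univ_succ]

lemma firstHit_zero (P : Matrix V V ℝ) (x z : V) :
    firstHit P x z 0 = if x = z then 1 else 0 := by
  unfold firstHit
  rw [Fintype.sum_equiv (Equiv.funUnique (Fin 1) V) _ (fun a => if a = x ∧ a = z then 1 else 0)]
  · simp [ite_and]
  · intro w
    simp [pathProb]

lemma firstHit_self_succ (P : Matrix V V ℝ) (z : V) (k : ℕ) : firstHit P z z (k + 1) = 0 := by
  refine Finset.sum_eq_zero fun w _ => if_neg ?_
  rintro ⟨h0, -, h⟩
  exact h 0 h0

lemma firstHit_succ (P : Matrix V V ℝ) {x z : V} (hxz : x ≠ z) (k : ℕ) :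
    firstHit P x z (k + 1) = ∑ u, P x u * firstHit P u z k := by
  have hcons : firstHit P x z (k + 1) = ∑ p : V × (Fin (k + 1) → V),
      if p.1 = x then
        if p.2 (Fin.last k) = z ∧ ∀ i : Fin k, p.2 i.castSucc ≠ z then
          P x (p.2 0) * pathProb P p.2 else 0
      else 0 := by
    refine (Fintype.sum_equiv (Fin.consEquiv fun _ : Fin (k + 1 + 1) => V) _ _ ?_).symm
    rintro ⟨a, w⟩
    by_cases ha : a = x
    · subst ha
      simp [Fin.consEquiv, Fin.forall_fin_succ, ← Fin.succ_last,
        pathProb_cons, hxz]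
    · simp [Fin.consEquiv, ha]
  rw [hcons, Fintype.sum_prod_type_right]
  simp only [firstHit, Finset.mul_sum]
  refine Eq.trans ?_ Finset.sum_comm
  refine Finset.sum_congr rfl fun w _ => ?_
  simp [ite_and]

/-- Decomposition of the `t`-step kernel at the first visit to `z`, provided `z` separates the
starting point from the target. The set `S` consists of starting points that are separated. -/
lemma pow_apply_eq_sum_firstHit (M : Matrix V V ℝ) (y z : V) (S : V → Prop)
    (hS : ∀ x u, S x → x ≠ z → M x u ≠ 0 → S u) (hy : S y → y = z) (t : ℕ) (x : V) (hx : S x) :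
    (M ^ t) x y = ∑ j ∈ Finset.range (t + 1), firstHit M x z j * (M ^ (t - j)) z y := by
  induction t generalizing x with
  | zero =>
    by_cases hxz : x = z
    · simp [firstHit_zero, hxz]
    · have hxy : x ≠ y := by
        rintro rfl
        exact hxz (hy hx)
      simp [firstHit_zero, hxz, hxy]
  | succ t ih =>
    rw [Finset.sum_range_succ']
    by_cases hxz : x = z
    · subst hxz
      simp [firstHit_zero, firstHit_self_succ]
    · have hstep : ∀ u, M x u * (M ^ t) u y =
          ∑ j ∈ Finset.range (t + 1), M x u * firstHit M u z j * (M ^ (t - j)) z y := by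
        intro u
        by_cases hu : M x u = 0
        · simp [hu]
        · simp only [ih u (hS x u hx hxz hu), Finset.mul_sum, mul_assoc]
      rw [pow_succ', Matrix.mul_apply, Finset.sum_congr rfl fun u _ => hstep u, Finset.sum_comm]
      simp [firstHit_zero, hxz, firstHit_succ M hxz, Finset.sum_mul]

lemma Rev.pow_s10 {M : Matrix V V ℝ} {π : V → ℝ} (h : Rev M π) (t : ℕ) : Rev (M ^ t) π := by
  induction t with
  | zero =>
    intro i j
    by_cases hij : i = j
    · rw [hij]
    · simp [hij, Ne.symm hij]
  | succ t ih =>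
    intro i j
    have hij : (M ^ (t + 1)) i j = ∑ u, (M ^ t) i u * M u j := by rw [pow_succ, Matrix.mul_apply]
    have hji : (M ^ (t + 1)) j i = ∑ u, M j u * (M ^ t) u i := by rw [pow_succ', Matrix.mul_apply]
    rw [hij, hji, Finset.mul_sum, Finset.mul_sum]
    refine Finset.sum_congr rfl fun u _ => ?_
    linear_combination M u j * ih i u + (M ^ t) u i * h u j

omit [Fintype V] in
lemma Rev.lazyM {P : Matrix V V ℝ} {π : V → ℝ} (h : Rev P π) : Rev (lazyM P) π := by
  intro i j
  by_cases hij : i = j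
  · rw [hij]
  · simp only [_root_.lazyM, Matrix.smul_apply, Matrix.add_apply, Matrix.one_apply_ne hij,
      Matrix.one_apply_ne (Ne.symm hij), smul_eq_mul]
    linear_combination 2⁻¹ * h i j

omit [Fintype V] in
lemma exists_eq_of_lazyM_ne_zero {P : Matrix V V ℝ} {x y z u : V} (hP : ∀ i j, 0 ≤ P i j)
    (hcut : ∀ (k : ℕ) (w : Fin (k + 1) → V), w 0 = x → w (Fin.last k) = y →
      (∀ i : Fin k, 0 < P (w i.castSucc) (w i.succ)) → ∃ i, w i = z)
    (hxz : x ≠ z) (hu : lazyM P x u ≠ 0)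
    (k : ℕ) (w : Fin (k + 1) → V) (h0 : w 0 = u) (hk : w (Fin.last k) = y)
    (hw : ∀ i : Fin k, 0 < P (w i.castSucc) (w i.succ)) : ∃ i, w i = z := by
  by_cases hxu : x = u
  · exact hcut k w (h0.trans hxu.symm) hk hw
  · have hpos : 0 < P x u := by
      refine lt_of_le_of_ne (hP x u) fun h => hu ?_
      simp [lazyM, Matrix.one_apply_ne hxu, ← h]
    obtain ⟨i, hi⟩ := hcut (k + 1) (Fin.cons x w) rfl (by simpa [← Fin.succ_last] using hk) (by
      refine Fin.cases ?_ fun i => ?_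
      · simpa [h0] using hpos
      · simpa [← Fin.succ_castSucc] using hw i)
    induction i using Fin.cases with
    | zero => exact absurd hi hxz
    | succ i => exact ⟨i, by simpa using hi⟩

/-- **Lemma 3.2 (ii).** If every path from `x` to `y` in the transition graph of `P` passes
through `z`, then `P_L^t(x,y)/π(y) = Σ_{k ≤ t} P[T_z^{x,y} = k] P_L^{t-k}(z,z)/π(z)`. -/
theorem lazy_kernel_cut_vertex_decomposition
    {N : ℕ} (P : Matrix (Fin N) (Fin N) ℝ) (π : Fin N → ℝ)
    (hP : IsStoch P) (hπ : IsProb π) (hrev : Rev P π) (hirr : Irred P)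
    (x y z : Fin N)
    (hcut : ∀ (k : ℕ) (w : Fin (k+1) → Fin N), w 0 = x → w (Fin.last k) = y →
      (∀ i : Fin k, 0 < P (w i.castSucc) (w i.succ)) → ∃ i, w i = z)
    (t : ℕ) :
    (lazyM P ^ t) x y / π y =
      ∑ k ∈ Finset.range (t+1),
        probDoubleHit (lazyM P) x y z k * (lazyM P ^ (t - k)) z z / π z := by
  have hxy := pow_apply_eq_sum_firstHit (lazyM P) y z
    (fun v => ∀ (k : ℕ) (w : Fin (k + 1) → Fin N), w 0 = v → w (Fin.last k) = y →
      (∀ i : Fin k, 0 < P (w i.castSucc) (w i.succ)) → ∃ i, w i = z)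
    (fun v u hv hvz hu => exists_eq_of_lazyM_ne_zero hP.1 hv hvz hu)
    (fun hy => by simpa using hy 0 (fun _ => y) rfl rfl (fun i => i.elim0)) t x hcut
  have hyz (s : ℕ) := pow_apply_eq_sum_firstHit (lazyM P) z z (fun _ => True)
    (fun _ _ _ _ _ => trivial) (fun _ => rfl) s y trivial
  have hzy (s : ℕ) : (lazyM P ^ s) z y / π y = (lazyM P ^ s) y z / π z := by
    rw [div_eq_div_iff (hπ.1 y).ne' (hπ.1 z).ne']
    linear_combination hrev.lazyM.pow_s10 s z y
  have hflip := Finset.sum_range_diag_flip (t + 1) fun j i =>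
    firstHit (lazyM P) x z j * firstHit (lazyM P) y z i * (lazyM P ^ (t - (j + i))) z z / π z
  simp only [probDoubleHit, Finset.sum_mul, Finset.sum_div]
  rw [hxy, Finset.sum_div]
  refine Eq.trans ?_ (hflip.symm.trans ?_)
  · refine Finset.sum_congr rfl fun j hj => ?_
    rw [mul_div_assoc, hzy, hyz, Finset.sum_div, Finset.mul_sum,
      Nat.sub_add_comm (Finset.mem_range_succ_iff.mp hj)]
    refine Finset.sum_congr rfl fun i _ => ?_
    rw [Nat.sub_sub]
    ring
  · refine Finset.sum_congr rfl fun k _ => Finset.sum_congr rfl fun j hj => ?_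
    rw [Nat.add_sub_cancel' (Finset.mem_range_succ_iff.mp hj)]

end
end

section
/- Let (Ω,P,π) be a finite irreducible reversible Markov chain with heat kernel H_t := exp(t(P−I)), and let x ≠ y in Ω. Let f_y^x(s) := Σ_{w≠y} [exp(sA)]_{x,w}·P(w,y) for s ≥ 0, where A is the restriction of P−I to (Ω∖{y})×(Ω∖{y}) (this is the density of the hitting time of y for the continuous-time chain started at x). Then for every M with f_y^x(s) ≤ M for all s ≥ 0 and every t ≥ 0, H_t(x,y)/π(y) ≤ H_x[T_y ≤ t] + t_rel·M·(1−π(y))/π(y), where H_x[T_y ≤ t] := 1 − Σ_{w≠y}[exp(tA)]_{x,w} and t_rel := 1/(1−λ₂) with λ₂ the second largest eigenvalue of P. -/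
open Filter Finset

noncomputable section

variable {V : Type} [Fintype V] [DecidableEq V]

/-- the density `f_y^x(s) = Σ_{w ≠ y} [exp(sA)]_{x,w} P(w,y)` of the hitting time of `y`
for the continuous-time chain started at `x ≠ y`, where `A` is the restriction of `P - I`
to the complement of `y`. -/
def ctsHitDensity (P : Matrix V V ℝ) {x y : V} (hxy : x ≠ y) (s : ℝ) : ℝ :=
  ∑ w : {w : V // w ≠ y}, heatRestr P y s ⟨x, hxy⟩ w * P w.1 y

/-- `H_x[T_y ≤ t] = 1 - Σ_{w ≠ y} [exp(tA)]_{x,w}` for `x ≠ y`. -/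
def ctsHitProb' (P : Matrix V V ℝ) {x y : V} (hxy : x ≠ y) (t : ℝ) : ℝ :=
  1 - ∑ w : {w : V // w ≠ y}, heatRestr P y t ⟨x, hxy⟩ w

/-! ### Exponentials of real matrices -/

section MatrixExp

open scoped Matrix.Norms.Operator

lemma hasSum_matrix_exp (A : Matrix V V ℝ) :
    HasSum (fun n : ℕ => ((n.factorial : ℝ))⁻¹ • A ^ n) (NormedSpace.exp A) :=
  NormedSpace.exp_series_hasSum_exp' A

lemma tsum_smul_pow_eq_exp (A : Matrix V V ℝ) (t : ℝ) :
    ∑' k : ℕ, (t ^ k / (Nat.factorial k : ℝ)) • A ^ k = NormedSpace.exp (t • A) := by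
  rw [← (hasSum_matrix_exp (t • A)).tsum_eq]
  refine tsum_congr fun k => ?_
  rw [smul_pow, smul_smul, div_eq_inv_mul]

lemma hasDerivAt_matrix_exp_apply (A : Matrix V V ℝ) (i j : V) (t : ℝ) :
    HasDerivAt (fun s : ℝ => NormedSpace.exp (s • A) i j)
      ((NormedSpace.exp (t • A) * A) i j) t := by
  have h := hasDerivAt_exp_smul_const A t
  exact ((LinearMap.toContinuousLinearMap (Matrix.entryLinearMap ℝ ℝ i j)).hasFDerivAt.comp_hasDerivAt t h)

lemma hasDerivAt_matrix_exp_apply' (A : Matrix V V ℝ) (i j : V) (t : ℝ) :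
    HasDerivAt (fun s : ℝ => NormedSpace.exp (s • A) i j)
      ((A * NormedSpace.exp (t • A)) i j) t := by
  rw [((Commute.refl A).smul_left t).exp_left.eq.symm]
  exact hasDerivAt_matrix_exp_apply A i j t

lemma matrix_exp_mulVec_of_eigenvector {A : Matrix V V ℝ} {v : V → ℝ} {μ : ℝ}
    (h : A.mulVec v = μ • v) :
    (NormedSpace.exp A).mulVec v = Real.exp μ • v := by
  have hpow : ∀ n : ℕ, (A ^ n).mulVec v = μ ^ n • v := by
    intro n
    induction n with
    | zero => simp
    | succ n ih =>
      rw [pow_succ, ← Matrix.mulVec_mulVec, h, Matrix.mulVec_smul, ih, smul_smul, pow_succ,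
        mul_comm]
  have h1 : HasSum (fun n : ℕ => ((n.factorial : ℝ)⁻¹ • A ^ n).mulVec v)
      ((NormedSpace.exp A).mulVec v) :=
    (hasSum_matrix_exp A).map ((Matrix.mulVecBilin ℝ ℝ).flip v)
      (continuous_id.matrix_mulVec continuous_const)
  have h2 : HasSum (fun n : ℕ => ((n.factorial : ℝ)⁻¹ • μ ^ n) • v) (Real.exp μ • v) := by
    rw [Real.exp_eq_exp_ℝ]
    exact (NormedSpace.exp_series_hasSum_exp' (𝕂 := ℝ) μ).smul_const v
  refine h1.unique (h2.congr_fun ?_)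
  intro n
  rw [Matrix.smul_mulVec, hpow, smul_smul, smul_eq_mul]

lemma matrix_exp_apply_nonneg {Q : Matrix V V ℝ} (hQ : ∀ i j, 0 ≤ Q i j) (i j : V) :
    0 ≤ NormedSpace.exp Q i j := by
  have hpow : ∀ n : ℕ, ∀ i j, 0 ≤ (Q ^ n) i j := by
    intro n
    induction n with
    | zero => intro i j; rw [pow_zero, Matrix.one_apply]; split_ifs <;> norm_num
    | succ n ih =>
      intro i j
      rw [pow_succ, Matrix.mul_apply]
      exact Finset.sum_nonneg fun k _ => mul_nonneg (ih i k) (hQ k j)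
  have h := (hasSum_matrix_exp Q).map (Matrix.entryAddMonoidHom ℝ i j)
    (continuous_id.matrix_elem i j)
  refine h.nonneg fun n => ?_
  simp only [Function.comp_apply, Matrix.entryAddMonoidHom_apply, Matrix.smul_apply, smul_eq_mul]
  have := hpow n i j
  positivity

lemma matrix_exp_smul_sub_one_apply_nonneg {Q : Matrix V V ℝ} (hQ : ∀ i j, 0 ≤ Q i j) {t : ℝ}
    (ht : 0 ≤ t) (i j : V) : 0 ≤ NormedSpace.exp (t • (Q - 1)) i j := by
  have h1 : t • (Q - 1) = t • Q + Matrix.diagonal (fun _ => -t) := by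
    ext a b
    by_cases hab : a = b <;> simp [hab] ; ring
  have hc : Commute (t • Q) (Matrix.diagonal (fun _ : V => -t)) := by
    rw [← Matrix.smul_one_eq_diagonal]
    exact (Commute.one_right _).smul_right _
  rw [h1, Matrix.exp_add_of_commute _ _ hc, Matrix.exp_diagonal, Matrix.mul_diagonal]
  refine mul_nonneg (matrix_exp_apply_nonneg (fun a b => ?_) i j) ?_
  · exact mul_nonneg ht (hQ a b)
  · rw [Pi.coe_exp, ← Real.exp_eq_exp_ℝ]
    exact (Real.exp_pos _).le

end MatrixExp

lemma heatKer_eq_exp (P : Matrix V V ℝ) (t : ℝ) :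
    heatKer P t = NormedSpace.exp (t • (P - 1)) :=
  tsum_smul_pow_eq_exp _ _

lemma heatRestr_eq_exp (P : Matrix V V ℝ) (y : V) (t : ℝ) :
    heatRestr P y t = NormedSpace.exp (t • restrQ P y) :=
  tsum_smul_pow_eq_exp _ _

lemma heatRestr_nonneg {P : Matrix V V ℝ} (hP : IsStoch P) (y : V) {t : ℝ} (ht : 0 ≤ t)
    (i j : {w : V // w ≠ y}) : 0 ≤ heatRestr P y t i j := by
  have h : restrQ P y = P.submatrix Subtype.val Subtype.val - 1 := by
    ext a b
    simp [restrQ, Matrix.one_apply]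
  rw [heatRestr_eq_exp, h]
  exact matrix_exp_smul_sub_one_apply_nonneg (fun a b => hP.1 _ _) ht i j

/-! ### Eigenvalues of a reversible chain -/

lemma dirichlet_eigenvector {P : Matrix V V ℝ} {π : V → ℝ} (hP : IsStoch P) (hrev : Rev P π)
    {f : V → ℝ} {μ : ℝ} (h : P.mulVec f = μ • f) :
    ∑ i, ∑ j, π i * P i j * (f i - f j) ^ 2 = 2 * (1 - μ) * ∑ i, π i * f i ^ 2 := by
  have hf : ∀ i, ∑ j, P i j * f j = μ * f i := fun i => congrFun h i
  have h1 : ∑ i, ∑ j, π i * P i j * f i ^ 2 = ∑ i, π i * f i ^ 2 := by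
    refine Finset.sum_congr rfl fun i _ => ?_
    rw [← Finset.sum_mul, ← Finset.mul_sum, hP.2 i, mul_one]
  have h2 : ∑ i, ∑ j, π i * P i j * f j ^ 2 = ∑ i, π i * f i ^ 2 := by
    rw [Finset.sum_comm, ← h1]
    exact Finset.sum_congr rfl fun i _ => Finset.sum_congr rfl fun j _ => by rw [hrev j i]
  have h3 : ∑ i, ∑ j, π i * P i j * (f i * f j) = μ * ∑ i, π i * f i ^ 2 := by
    rw [Finset.mul_sum]
    refine Finset.sum_congr rfl fun i _ => ?_
    calc ∑ j, π i * P i j * (f i * f j) = π i * f i * ∑ j, P i j * f j := by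
          rw [Finset.mul_sum]; exact Finset.sum_congr rfl fun j _ => by ring
      _ = _ := by rw [hf]; ring
  calc ∑ i, ∑ j, π i * P i j * (f i - f j) ^ 2
      = ∑ i, ∑ j, π i * P i j * f i ^ 2 + ∑ i, ∑ j, π i * P i j * f j ^ 2
        - 2 * ∑ i, ∑ j, π i * P i j * (f i * f j) := by
        rw [Finset.mul_sum, ← Finset.sum_add_distrib, ← Finset.sum_sub_distrib]
        refine Finset.sum_congr rfl fun i _ => ?_
        rw [Finset.mul_sum, ← Finset.sum_add_distrib, ← Finset.sum_sub_distrib]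
        exact Finset.sum_congr rfl fun j _ => by ring
    _ = _ := by rw [h1, h2, h3]; ring

lemma eigenvalue_le_one {P : Matrix V V ℝ} {π : V → ℝ} (hP : IsStoch P) (hπ : IsProb π)
    (hrev : Rev P π) {f : V → ℝ} {μ : ℝ} (hf : f ≠ 0) (h : P.mulVec f = μ • f) : μ ≤ 1 := by
  obtain ⟨z, hz⟩ := Function.ne_iff.mp hf
  have hpos : 0 < ∑ i, π i * f i ^ 2 :=
    Finset.sum_pos' (fun i _ => mul_nonneg (hπ.1 i).le (sq_nonneg _))
      ⟨z, Finset.mem_univ _, mul_pos (hπ.1 z) (sq_pos_of_ne_zero hz)⟩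
  have hE : 0 ≤ ∑ i, ∑ j, π i * P i j * (f i - f j) ^ 2 :=
    Finset.sum_nonneg fun i _ => Finset.sum_nonneg fun j _ =>
      mul_nonneg (mul_nonneg (hπ.1 i).le (hP.1 i j)) (sq_nonneg _)
  rw [dirichlet_eigenvector hP hrev h] at hE
  by_contra! hμ
  nlinarith

lemma harmonic_eq_const {P : Matrix V V ℝ} {π : V → ℝ} (hP : IsStoch P) (hπ : IsProb π)
    (hrev : Rev P π) (hirr : Irred P) {f : V → ℝ} (h : P.mulVec f = (1 : ℝ) • f) (i j : V) :
    f i = f j := by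
  have hE := dirichlet_eigenvector hP hrev h
  have hnn : ∀ i j, 0 ≤ π i * P i j * (f i - f j) ^ 2 := fun i j =>
    mul_nonneg (mul_nonneg (hπ.1 i).le (hP.1 i j)) (sq_nonneg _)
  rw [sub_self, mul_zero, zero_mul,
    Finset.sum_eq_zero_iff_of_nonneg fun i _ => Finset.sum_nonneg fun j _ => hnn i j] at hE
  have hedge : ∀ i j, P i j ≠ 0 → f i = f j := by
    intro i j hij
    have h1 := (Finset.sum_eq_zero_iff_of_nonneg fun j _ => hnn i j).mp
      (hE i (Finset.mem_univ _)) j (Finset.mem_univ _)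
    have h2 := (mul_eq_zero.mp h1).resolve_left (mul_ne_zero (hπ.1 i).ne' hij)
    exact sub_eq_zero.mp (pow_eq_zero_iff (two_ne_zero)|>.mp h2)
  have hpath : ∀ t : ℕ, ∀ i j, (P ^ t) i j ≠ 0 → f i = f j := by
    intro t
    induction t with
    | zero =>
      intro i j hij
      by_contra hne
      exact hij (by rw [pow_zero, Matrix.one_apply_ne (fun e => hne (congrArg f e))])
    | succ t ih =>
      intro i j hij
      rw [pow_succ, Matrix.mul_apply] at hij
      obtain ⟨k, -, hk⟩ := Finset.exists_ne_zero_of_sum_ne_zero hij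
      exact (ih i k (left_ne_zero_of_mul hk)).trans (hedge k j (right_ne_zero_of_mul hk))
  obtain ⟨t, ht⟩ := hirr i j
  exact hpath t i j ht.ne'

lemma eigenvalue_le_lam2 {P : Matrix V V ℝ} {π : V → ℝ} (hP : IsStoch P) (hπ : IsProb π)
    (hrev : Rev P π) {f : V → ℝ} {μ : ℝ} (hμ : μ ≠ 1) (hf : f ≠ 0) (h : P.mulVec f = μ • f) :
    μ ≤ lam2 P :=
  le_csSup ⟨1, fun _ ⟨_, _, hg, hν⟩ => eigenvalue_le_one hP hπ hrev hg hν⟩ ⟨hμ, f, hf, h⟩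

lemma lam2_lt_one {P : Matrix V V ℝ} {π : V → ℝ} (hP : IsStoch P) (hπ : IsProb π)
    (hrev : Rev P π) : lam2 P < 1 := by
  rcases Set.eq_empty_or_nonempty
    {μ : ℝ | μ ≠ 1 ∧ ∃ f : V → ℝ, f ≠ 0 ∧ P.mulVec f = μ • f} with he | hne
  · rw [lam2, he, Real.sSup_empty]
    exact one_pos
  · have hfin : {μ : ℝ | μ ≠ 1 ∧ ∃ f : V → ℝ, f ≠ 0 ∧ P.mulVec f = μ • f}.Finite := by
      refine (Module.End.finite_hasEigenvalue (Matrix.toLin' P)).subset ?_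
      rintro μ ⟨-, f, hf, h⟩
      exact Module.End.hasEigenvalue_of_hasEigenvector
        (x := f) (Module.End.hasEigenvector_iff.mpr
          ⟨Module.End.mem_eigenspace_iff.mpr (by rw [Matrix.toLin'_apply, h]), hf⟩)
    rw [lam2, hfin.csSup_lt_iff hne]
    rintro μ ⟨hμ, f, hf, h⟩
    exact lt_of_le_of_ne (eigenvalue_le_one hP hπ hrev hf h) hμ

/-- The eigenfunctions of a reversible chain form an orthonormal basis after multiplication by
the square root of the stationary distribution. -/
lemma exists_orthonormal_eigenfunctions {P : Matrix V V ℝ} {π : V → ℝ} (hπ : IsProb π)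
    (hrev : Rev P π) :
    ∃ (b : OrthonormalBasis V ℝ (EuclideanSpace ℝ V)) (ev : V → ℝ),
      ∀ k, P.mulVec (fun i => b k i / √(π i)) = ev k • fun i => b k i / √(π i) := by
  have hs : ∀ i, 0 < √(π i) := fun i => Real.sqrt_pos.mpr (hπ.1 i)
  set S : Matrix V V ℝ := Matrix.of fun i j => √(π i) * P i j / √(π j) with hS
  have hH : S.IsHermitian := by
    ext i j
    simp only [hS, Matrix.conjTranspose_apply, Matrix.of_apply, star_trivial]
    rw [div_eq_div_iff (hs i).ne' (hs j).ne']
    have h1 := Real.mul_self_sqrt (hπ.1 i).le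
    have h2 := Real.mul_self_sqrt (hπ.1 j).le
    have h3 := hrev i j
    rw [← h1, ← h2] at h3
    linear_combination -h3
  refine ⟨hH.eigenvectorBasis, hH.eigenvalues, fun k => ?_⟩
  ext i
  have h := congrFun (hH.mulVec_eigenvectorBasis k) i
  simp only [Matrix.mulVec, dotProduct, Pi.smul_apply, smul_eq_mul, hS, Matrix.of_apply] at h ⊢
  rw [← mul_div_assoc, ← h, eq_div_iff (hs i).ne', Finset.sum_mul]
  exact Finset.sum_congr rfl fun j _ => by ring

/-- Spectral bound on the return probability of a reversible continuous-time chain. -/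
lemma heatKer_diag_le {P : Matrix V V ℝ} {π : V → ℝ} (hP : IsStoch P) (hπ : IsProb π)
    (hrev : Rev P π) (hirr : Irred P) (y : V) {u : ℝ} (hu : 0 ≤ u) :
    heatKer P u y y ≤ π y + Real.exp (-(u * (1 - lam2 P))) * (1 - π y) := by
  have hs : ∀ i, 0 < √(π i) := fun i => Real.sqrt_pos.mpr (hπ.1 i)
  obtain ⟨b, ev, hb⟩ := exists_orthonormal_eigenfunctions (P := P) hπ hrev
  have hne : ∀ k, (fun i => b k i / √(π i)) ≠ 0 := by
    intro k h0
    refine b.orthonormal.ne_zero k ?_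
    ext i
    simpa [(hs i).ne'] using congrFun h0 i
  have hcompl : ∀ z, ∑ k, b k z * b k y = if z = y then 1 else 0 := by
    intro z
    have h := b.sum_inner_mul_inner (EuclideanSpace.single z (1 : ℝ)) (EuclideanSpace.single y 1)
    simpa [EuclideanSpace.inner_single_left, EuclideanSpace.inner_single_right, eq_comm] using h
  have hrep : heatKer P u y y = ∑ k, Real.exp (u * (ev k - 1)) * b k y ^ 2 := by
    have hdelta : (Pi.single y 1 : V → ℝ)
        = ∑ k, (√(π y) * b k y) • fun i => b k i / √(π i) := by
      ext z
      have h : ∑ k, √(π y) * b k y * (b k z / √(π z)) = √(π y) / √(π z) * ∑ k, b k z * b k y := by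
        rw [Finset.mul_sum]
        exact Finset.sum_congr rfl fun k _ => by ring
      simp only [Finset.sum_apply, Pi.smul_apply, smul_eq_mul, h, hcompl]
      by_cases hz : z = y
      · subst hz
        simp [(hs z).ne']
      · simp [hz]
    have hexp : ∀ k, (heatKer P u).mulVec (fun i => b k i / √(π i))
        = Real.exp (u * (ev k - 1)) • fun i => b k i / √(π i) := by
      intro k
      rw [heatKer_eq_exp]
      refine matrix_exp_mulVec_of_eigenvector ?_
      rw [Matrix.smul_mulVec, Matrix.sub_mulVec, hb, Matrix.one_mulVec, mul_smul, sub_smul,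
        one_smul]
    calc heatKer P u y y = (heatKer P u).mulVec (Pi.single y 1) y := by simp
      _ = ∑ k, √(π y) * b k y * (Real.exp (u * (ev k - 1)) * (b k y / √(π y))) := by
          rw [hdelta, Matrix.mulVec_sum, Finset.sum_apply]
          refine Finset.sum_congr rfl fun k _ => ?_
          rw [Matrix.mulVec_smul, hexp]
          simp only [Pi.smul_apply, smul_eq_mul]
      _ = _ := by
          refine Finset.sum_congr rfl fun k _ => ?_
          field_simp [(hs y).ne']
  have hsum1 : ∑ k, b k y ^ 2 = 1 := by
    simpa [sq] using hcompl y
  have hone : ∀ k, ev k = 1 → ∃ c : ℝ, c ^ 2 = 1 ∧ ∀ i, b k i = c * √(π i) := by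
    intro k hk
    have hconst := harmonic_eq_const hP hπ hrev hirr (hk ▸ hb k)
    refine ⟨b k y / √(π y), ?_, fun i => ?_⟩
    · have hnorm : ∑ i, b k i ^ 2 = 1 := by
        have h := EuclideanSpace.real_norm_sq_eq (b k)
        rw [b.orthonormal.1 k, one_pow] at h
        exact h.symm
      have h2 : ∀ i, b k i ^ 2 = (b k y / √(π y)) ^ 2 * π i := by
        intro i
        rw [← hconst i y, div_pow, Real.sq_sqrt (hπ.1 i).le, div_mul_cancel₀ _ (hπ.1 i).ne']
      rw [Finset.sum_congr rfl fun i _ => h2 i, ← Finset.mul_sum, hπ.2, mul_one] at hnorm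
      exact hnorm
    · rw [← hconst i y, div_mul_cancel₀ _ (hs i).ne']
  have huniq : ∀ k l, ev k = 1 → ev l = 1 → k = l := by
    intro k l hk hl
    by_contra hkl
    obtain ⟨c, hc, hc'⟩ := hone k hk
    obtain ⟨d, hd, hd'⟩ := hone l hl
    have h : inner ℝ (b k) (b l) = 0 := b.orthonormal.2 hkl
    have h' : ∑ i, b k i * b l i = 0 := by
      rw [PiLp.inner_apply] at h
      simpa [mul_comm] using h
    have h2 : ∀ i, b k i * b l i = c * d * π i := by
      intro i
      rw [hc', hd']
      linear_combination c * d * Real.mul_self_sqrt (hπ.1 i).le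
    rw [Finset.sum_congr rfl fun i _ => h2 i, ← Finset.mul_sum, hπ.2, mul_one] at h'
    have h3 : c ^ 2 * d ^ 2 = 0 := by rw [← mul_pow, h']; norm_num
    rw [hc, hd] at h3
    norm_num at h3
  have hmass : ∑ k with ev k = 1, b k y ^ 2 ≤ π y := by
    rcases (Finset.univ.filter fun k => ev k = 1).eq_empty_or_nonempty with he | ⟨k, hk⟩
    · rw [he, Finset.sum_empty]
      exact (hπ.1 y).le
    · have hk1 := (Finset.mem_filter.mp hk).2
      have he : (Finset.univ.filter fun k => ev k = 1) = {k} := by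
        ext l
        simp only [Finset.mem_filter, Finset.mem_univ, true_and, Finset.mem_singleton]
        exact ⟨fun hl => huniq l k hl hk1, fun hl => hl ▸ hk1⟩
      obtain ⟨c, hc, hc'⟩ := hone k hk1
      rw [he, Finset.sum_singleton, hc', mul_pow, hc, one_mul, Real.sq_sqrt (hπ.1 y).le]
  set r := Real.exp (-(u * (1 - lam2 P))) with hr
  have hr1 : r ≤ 1 := Real.exp_le_one_iff.mpr
    (neg_nonpos.mpr (mul_nonneg hu (sub_nonneg.mpr (lam2_lt_one hP hπ hrev).le)))
  have hbound : ∀ k, Real.exp (u * (ev k - 1)) * b k y ^ 2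
      ≤ r * b k y ^ 2 + (1 - r) * (if ev k = 1 then b k y ^ 2 else 0) := by
    intro k
    by_cases hk : ev k = 1
    · simp only [hk, sub_self, mul_zero, Real.exp_zero, one_mul, if_true]
      linarith
    · have hle := eigenvalue_le_lam2 hP hπ hrev hk (hne k) (hb k)
      simp only [hk, if_false, mul_zero, add_zero]
      refine mul_le_mul_of_nonneg_right (Real.exp_le_exp.mpr ?_) (sq_nonneg _)
      nlinarith
  calc heatKer P u y y
      ≤ ∑ k, (r * b k y ^ 2 + (1 - r) * (if ev k = 1 then b k y ^ 2 else 0)) := by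
        rw [hrep]
        exact Finset.sum_le_sum fun k _ => hbound k
    _ = r + (1 - r) * ∑ k with ev k = 1, b k y ^ 2 := by
        rw [Finset.sum_add_distrib, ← Finset.mul_sum, ← Finset.mul_sum, hsum1, mul_one,
          Finset.sum_filter]
    _ ≤ r + (1 - r) * π y := by gcongr
    _ = _ := by ring

/-! ### The first-passage decomposition in differential form -/

lemma restrQ_row_sum {P : Matrix V V ℝ} (hP : IsStoch P) (y : V) (w : {w : V // w ≠ y}) :
    ∑ v, restrQ P y w v = -P w.1 y := by
  have h := hP.2 w.1
  rw [← Finset.add_sum_erase _ _ (Finset.mem_univ y),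
    Finset.sum_subtype (p := fun v => v ≠ y) _ (fun v => by simp) (P w.1)] at h
  simp only [restrQ, Matrix.of_apply, Finset.sum_sub_distrib, Finset.sum_ite_eq, Finset.mem_univ,
    if_true]
  linarith

lemma hasDerivAt_sum_heatRestr {P : Matrix V V ℝ} (hP : IsStoch P) {x y : V} (hxy : x ≠ y)
    (s : ℝ) :
    HasDerivAt (fun s => ∑ w : {w : V // w ≠ y}, heatRestr P y s ⟨x, hxy⟩ w)
      (-ctsHitDensity P hxy s) s := by
  have h := HasDerivAt.fun_sum (u := Finset.univ) fun (w : {w : V // w ≠ y}) _ =>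
    hasDerivAt_matrix_exp_apply (restrQ P y) ⟨x, hxy⟩ w s
  simp only [heatRestr_eq_exp]
  refine h.congr_deriv ?_
  simp only [Matrix.mul_apply]
  rw [Finset.sum_comm, ctsHitDensity, ← Finset.sum_neg_distrib]
  refine Finset.sum_congr rfl fun w _ => ?_
  rw [← Finset.mul_sum, restrQ_row_sum hP, heatRestr_eq_exp]
  ring

lemma hasDerivAt_heatKer_sub (P : Matrix V V ℝ) (t s : ℝ) (w y : V) :
    HasDerivAt (fun s => heatKer P (t - s) w y)
      (-((P - 1) * heatKer P (t - s)) w y) s := by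
  simp only [heatKer_eq_exp]
  have h := (hasDerivAt_matrix_exp_apply' (P - 1) w y (t - s)).comp s
    ((hasDerivAt_id s).const_sub t)
  refine h.congr_deriv ?_
  simp

lemma sub_one_mul_apply_ne (P K : Matrix V V ℝ) (y : V) (w : {w : V // w ≠ y}) :
    ((P - 1) * K) w.1 y
      = P w.1 y * K y y + ∑ v : {w : V // w ≠ y}, restrQ P y w v * K v.1 y := by
  rw [Matrix.mul_apply, ← Finset.add_sum_erase _ _ (Finset.mem_univ y),
    Finset.sum_subtype (p := fun v => v ≠ y) _ (fun v => by simp)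
      (fun v => (P - 1) w.1 v * K v y)]
  congr 1
  · simp [w.2]
  · refine Finset.sum_congr rfl fun v _ => ?_
    simp [restrQ, Matrix.one_apply, Subtype.ext_iff]

lemma hasDerivAt_killed_then_free (P : Matrix V V ℝ) {x y : V} (hxy : x ≠ y) (t s : ℝ) :
    HasDerivAt
      (fun s => ∑ w : {w : V // w ≠ y}, heatRestr P y s ⟨x, hxy⟩ w * heatKer P (t - s) w.1 y)
      (-(ctsHitDensity P hxy s * heatKer P (t - s) y y)) s := by
  have h := HasDerivAt.fun_sum (u := Finset.univ) fun (w : {w : V // w ≠ y}) _ =>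
    (hasDerivAt_matrix_exp_apply (restrQ P y) ⟨x, hxy⟩ w s).mul
      (hasDerivAt_heatKer_sub P t s w.1 y)
  simp only [← heatRestr_eq_exp] at h
  refine h.congr_deriv ?_
  simp only [Matrix.mul_apply (M := heatRestr P y s), sub_one_mul_apply_ne, ctsHitDensity,
    mul_neg, mul_add, neg_add, Finset.sum_add_distrib, Finset.sum_mul, Finset.mul_sum,
    Finset.sum_neg_distrib]
  rw [Finset.sum_comm]
  simp only [mul_assoc]
  ring

/-- **Eq. (3.4) of Lemma 3.2.** If the density of the hitting time of `y` from `x` is bounded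
by `M`, then `H_t(x,y)/π(y) ≤ H_x[T_y ≤ t] + t_rel · M · (1-π(y))/π(y)`. -/
theorem cts_kernel_upper_bound_by_hitting
    {N : ℕ} (P : Matrix (Fin N) (Fin N) ℝ) (π : Fin N → ℝ)
    (hP : IsStoch P) (hπ : IsProb π) (hrev : Rev P π) (hirr : Irred P)
    (x y : Fin N) (hxy : x ≠ y)
    (M : ℝ) (hM : ∀ s : ℝ, 0 ≤ s → ctsHitDensity P hxy s ≤ M)
    (t : ℝ) (ht : 0 ≤ t) :
    heatKer P t x y / π y ≤
      ctsHitProb' P hxy t + trel P * M * (1 - π y) / π y := by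
  have hgap : 0 < 1 - lam2 P := sub_pos.mpr (lam2_lt_one hP hπ hrev)
  have hy : 0 < π y := hπ.1 y
  have hy1 : π y ≤ 1 := hπ.2 ▸ Finset.single_le_sum (fun i _ => (hπ.1 i).le) (Finset.mem_univ y)
  have hdens : ∀ s, 0 ≤ s → 0 ≤ ctsHitDensity P hxy s := fun s hs =>
    Finset.sum_nonneg fun w _ => mul_nonneg (heatRestr_nonneg hP y hs _ _) (hP.1 _ _)
  have hM0 : 0 ≤ M := (hdens 0 le_rfl).trans (hM 0 le_rfl)
  set g := 1 - lam2 P with hg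
  set c := (1 - π y) / π y with hc
  have hc0 : 0 ≤ c := div_nonneg (by linarith) hy.le
  let ψ : ℝ → ℝ := fun s =>
    (∑ w : {w // w ≠ y}, heatRestr P y s ⟨x, hxy⟩ w * heatKer P (t - s) w.1 y) / π y
      - ∑ w : {w // w ≠ y}, heatRestr P y s ⟨x, hxy⟩ w
      + M * c / g * Real.exp (-((t - s) * g))
  have hψ : ∀ s, HasDerivAt ψ (-(ctsHitDensity P hxy s * heatKer P (t - s) y y) / π y
      - -ctsHitDensity P hxy s + M * c / g * (Real.exp (-((t - s) * g)) * g)) s := by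
    intro s
    have he : HasDerivAt (fun s => -((t - s) * g)) g s := by
      refine (((hasDerivAt_id s).const_sub t).mul_const g).neg.congr_deriv ?_
      ring
    exact (((hasDerivAt_killed_then_free P hxy t s).div_const _).sub
      (hasDerivAt_sum_heatRestr hP hxy s)).add (he.exp.const_mul _)
  have hmono : MonotoneOn ψ (Set.Icc 0 t) := by
    refine monotoneOn_of_deriv_nonneg (convex_Icc 0 t)
      (fun s _ => (hψ s).continuousAt.continuousWithinAt)
      (fun s _ => (hψ s).differentiableAt.differentiableWithinAt) fun s hs => ?_
    rw [interior_Icc] at hs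
    rw [(hψ s).deriv]
    have hf0 := hdens s hs.1.le
    have hfM := hM s hs.1.le
    have hdiag := heatKer_diag_le hP hπ hrev hirr y (u := t - s) (by linarith [hs.2])
    have hdiag' : heatKer P (t - s) y y / π y ≤ 1 + Real.exp (-((t - s) * g)) * c := by
      rw [div_le_iff₀ hy]
      refine hdiag.trans_eq ?_
      rw [hc, ← hg]
      field_simp
    have h1 := mul_le_mul_of_nonneg_left hdiag' hf0
    have h2 := mul_le_mul_of_nonneg_right hfM
      (mul_nonneg (Real.exp_pos (-((t - s) * g))).le hc0)
    have h3 : M * c / g * (Real.exp (-((t - s) * g)) * g)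
        = M * (Real.exp (-((t - s) * g)) * c) := by field_simp
    rw [h3, neg_div, mul_div_assoc]
    linarith
  have hle := hmono (Set.left_mem_Icc.mpr ht) (Set.right_mem_Icc.mpr ht) ht
  have hψ0 : ψ 0 = heatKer P t x y / π y - 1 + M * c / g * Real.exp (-(t * g)) := by
    simp [ψ, heatRestr_eq_exp, Matrix.one_apply]
  have hψt : ψ t = -(∑ w : {w // w ≠ y}, heatRestr P y t ⟨x, hxy⟩ w) + M * c / g := by
    have h0 : ∀ w : {w // w ≠ y}, heatKer P 0 w.1 y = 0 := fun w => by
      simp [heatKer_eq_exp, w.2]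
    simp [ψ, h0]
  rw [hψ0, hψt] at hle
  have hpos : 0 ≤ M * c / g * Real.exp (-(t * g)) := by positivity
  have hlast : trel P * M * (1 - π y) / π y = M * c / g := by
    rw [trel, ← hg, hc]
    field_simp
  rw [ctsHitProb', hlast]
  linarith

end
end
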